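/- arXiv:2511.07906 — 2 statements merged into one kernel-verified Lean document; each statement's English description precedes it below -/
import Mathlib

section
/- Let σ = (σ_G, σ_⋈) be a twist of a self-similar action (G,E), with σ_⋈ extended to G*E^*. Then the formula ω_σ((α,g,β),(γ,h,δ)) = σ_⋈(g,β')·σ_G(g|_{β'}, h) if γ = ββ', and ω_σ((α,g,β),(γ,h,δ)) = σ_G(g, (h⁻¹|_{γ'})⁻¹)·σ_⋈(h, h⁻¹·γ') if β = γγ', gives a well-defined normalised 𝕋-valued 2-cocycle on the inverse semigroup S(G,E): ω_σ(s,t)·ω_σ(r,s·t) = ω_σ(r,s)·ω_σ(r·s,t) whenever r·s·t ≠ 0 in S(G,E), and ω_σ(f_α,f_α) = 1 for every nonzero idempotent f_α. -/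
noncomputable section

attribute [local instance] Classical.propDecidable

/-- Raw algebraic data of an inverse semigroup with zero, together with a domain
predicate singling out its genuine elements (the carrier may contain junk). -/
structure RawSem (T : Type) where
  mul : T → T → T
  star : T → T
  zero : T
  dom : T → Prop

namespace RawSem

variable {T : Type} (R : RawSem T)

/-- The natural partial order: `t ≤ u` iff `t = u ⬝ t* ⬝ t`. -/
def le (t u : T) : Prop := t = R.mul u (R.mul (R.star t) t)

/-- Nonzero idempotents (belonging to the domain). -/
def NzIdem (e : T) : Prop := R.dom e ∧ R.mul e e = e ∧ e ≠ R.zero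

/-- `F` covers the idempotent `e`: every nonzero idempotent below `e` meets some `f ∈ F`. -/
def Covers (F : Set T) (e : T) : Prop :=
  ∀ z, R.NzIdem z → R.le z e → ∃ f ∈ F, R.mul z f ≠ R.zero

/-- The set `F_t` of nonzero idempotents trivially fixed by `t`, i.e. `≤ t`. -/
def TrivFix (t : T) : Set T := {e | R.NzIdem e ∧ R.le e t}

/-- The idempotent `e` is fixed by `t`:
`(t ⬝ f ⬝ t*) ⬝ f ≠ 0` for every nonzero idempotent `f ≤ e`. -/
def FixedBy (e t : T) : Prop :=
  ∀ f, R.NzIdem f → R.le f e → R.mul (R.mul (R.mul t f) (R.star t)) f ≠ R.zero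

/-- The inverse semigroup is closed. -/
def Closed : Prop :=
  ∀ t, R.dom t → ∃ F : Finset T, ↑F ⊆ R.TrivFix t ∧ ∀ e ∈ R.TrivFix t, R.Covers ↑F e

/-- The inverse semigroup is topologically free. -/
def TopFree : Prop :=
  ∀ t e, R.dom t → R.NzIdem e → R.FixedBy e t → ∃ f ∈ R.TrivFix t, R.mul f e ≠ R.zero

/-- The inverse semigroup is effective. -/
def Effective : Prop :=
  ∀ t e, R.dom t → R.NzIdem e → R.FixedBy e t →
    ∃ F : Finset T, ↑F ⊆ R.TrivFix t ∧ R.Covers (↑F) e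

/-- The inverse semigroup is minimal. -/
def Minimal : Prop :=
  ∀ e f, R.NzIdem e → R.NzIdem f → ∃ Ts : Finset T, (∀ t ∈ Ts, R.dom t) ∧
    R.Covers ((fun t => R.mul (R.mul t f) (R.star t)) '' ↑Ts) e

/-- The inverse semigroup is quasi-fundamental. -/
def QuasiFund : Prop :=
  ∀ s t, R.dom s → R.dom t → s ≠ R.zero → t ≠ R.zero →
    (∀ e, R.NzIdem e → R.mul (R.mul s e) (R.star s) = R.mul (R.mul t e) (R.star t)) →
    ∃ u, R.dom u ∧ u ≠ R.zero ∧ R.le u s ∧ R.le u t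

/-- The inverse semigroup is fundamental. -/
def Fund : Prop :=
  ∀ s t, R.dom s → R.dom t →
    (∀ e, R.NzIdem e → R.mul (R.mul s e) (R.star s) = R.mul (R.mul t e) (R.star t)) → s = t

/-- The inverse semigroup is `E*`-unitary. -/
def EUnitary : Prop := ∀ t e, R.dom t → R.NzIdem e → R.le e t → R.mul t t = t

/-- The inverse semigroup is locally contracting. -/
def LocContr : Prop :=
  ∀ e, R.NzIdem e → ∃ s, R.dom s ∧ ∃ F : Finset T, ∃ f₀ ∈ F,
    (∀ f ∈ F, R.NzIdem f ∧ R.le f (R.mul e (R.mul (R.star s) s))) ∧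
    ∀ f ∈ F, R.Covers (↑F) (R.mul (R.mul s f) (R.star s)) ∧
      R.mul f₀ (R.mul (R.mul s f) (R.star s)) = R.zero

/-- The inverse semigroup is strongly locally contracting. -/
def StrLocContr : Prop :=
  ∀ e, R.NzIdem e → ∃ s f₀ f₁, R.dom s ∧ R.NzIdem f₀ ∧ R.NzIdem f₁ ∧
    R.le f₀ f₁ ∧ R.le f₁ (R.mul e (R.mul (R.star s) s)) ∧
    R.le (R.mul (R.mul s f₁) (R.star s)) f₁ ∧
    R.mul f₀ (R.mul (R.mul s f₁) (R.star s)) = R.zero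

end RawSem

/-- A self-similar action `(G, E)` of a discrete groupoid `G` on a directed graph `E`
sharing the vertex/unit set `V`, encoded by total operations together with axioms
that hold on composable inputs.  Arrows `g` have source `gs g` and range `gr g`;
edges `e` have source `es e` and range `er e`; `g · e` (written `act g e`) and
`g |_e` (written `res g e`) are meaningful when `gs g = er e`. -/
structure SSA where
  V : Type
  G : Type
  E : Type
  gs : G → V
  gr : G → V
  es : E → V
  er : E → V
  one : V → G
  mul : G → G → G
  inv : G → G
  act : G → E → E
  res : G → E → G
  gs_one : ∀ v, gs (one v) = v
  gr_one : ∀ v, gr (one v) = v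
  gs_mul : ∀ g h, gs g = gr h → gs (mul g h) = gs h
  gr_mul : ∀ g h, gs g = gr h → gr (mul g h) = gr g
  mul_assoc' : ∀ g h k, gs g = gr h → gs h = gr k → mul (mul g h) k = mul g (mul h k)
  one_mul' : ∀ g, mul (one (gr g)) g = g
  mul_one' : ∀ g, mul g (one (gs g)) = g
  gs_inv : ∀ g, gs (inv g) = gr g
  gr_inv : ∀ g, gr (inv g) = gs g
  mul_inv' : ∀ g, mul g (inv g) = one (gr g)
  inv_mul' : ∀ g, mul (inv g) g = one (gs g)
  er_act : ∀ g e, gs g = er e → er (act g e) = gr g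
  act_one : ∀ e, act (one (er e)) e = e
  act_mul : ∀ g h e, gs g = gr h → gs h = er e → act (mul g h) e = act g (act h e)
  gs_res : ∀ g e, gs g = er e → gs (res g e) = es e
  gr_res : ∀ g e, gs g = er e → gr (res g e) = es (act g e)
  res_mul : ∀ g h e, gs g = gr h → gs h = er e →
    res (mul g h) e = mul (res g (act h e)) (res h e)

namespace SSA

/-- Finite paths in the graph: `Pth S a b` is the type of paths with range `a`
and source `b`; `cons e p` is the path `e · p`. -/
inductive Pth (S : SSA) : S.V → S.V → Type
  | nil (v : S.V) : Pth S v v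
  | cons (e : S.E) {b : S.V} (p : Pth S (S.es e) b) : Pth S (S.er e) b

/-- The path category `E^*`, bundled: a finite path with its range and source. -/
structure Path (S : SSA) where
  rng : S.V
  src : S.V
  pth : S.Pth rng src

/-- Infinite paths: sequences of edges `e₁e₂⋯` with `es eᵢ = er e_{i+1}`. -/
structure InfPath (S : SSA) where
  seq : ℕ → S.E
  chain : ∀ n, S.es (seq n) = S.er (seq (n + 1))

/-- A twist `σ = (σ_G, σ_⋈)` of the self-similar action, with values in the
unit circle `𝕋 ⊆ ℂ`. -/
structure Twist (S : SSA) where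
  σG : S.G → S.G → ℂ
  σB : S.G → S.E → ℂ
  σG_unimod : ∀ g h, S.gs g = S.gr h → ‖σG g h‖ = 1
  σB_unimod : ∀ g e, S.gs g = S.er e → ‖σB g e‖ = 1
  σG_cocycle : ∀ g h k, S.gs g = S.gr h → S.gs h = S.gr k →
    σG g h * σG (S.mul g h) k = σG h k * σG g (S.mul h k)
  σG_one_left : ∀ g, σG (S.one (S.gr g)) g = 1
  σG_one_right : ∀ g, σG g (S.one (S.gs g)) = 1
  σB_one : ∀ e, σB (S.one (S.er e)) e = 1
  σB_cocycle : ∀ g h e, S.gs g = S.gr h → S.gs h = S.er e →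
    σB h e * (starRingEnd ℂ) (σB (S.mul g h) e) * σB g (S.act h e) =
      (starRingEnd ℂ) (σG (S.res g (S.act h e)) (S.res h e)) * σG g h

variable {S : SSA}

namespace Pth

def length : ∀ {a b : S.V}, S.Pth a b → ℕ
  | _, _, .nil _ => 0
  | _, _, .cons _ p => length p + 1

def toList : ∀ {a b : S.V}, S.Pth a b → List S.E
  | _, _, .nil _ => []
  | _, _, .cons e p => e :: toList p

def comp : ∀ {a b c : S.V}, S.Pth a b → S.Pth b c → S.Pth a c
  | _, _, _, .nil _, q => q
  | _, _, _, .cons e p, q => .cons e (comp p q)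

end Pth

def Path.length (p : Path S) : ℕ := p.pth.length

def Path.toList (p : Path S) : List S.E := p.pth.toList

/-- A vertex regarded as a path of length `0`. -/
def Path.vert (S : SSA) (v : S.V) : Path S := ⟨v, v, .nil v⟩

/-- An edge regarded as a path of length `1`. -/
def Path.ofEdge (S : SSA) (e : S.E) : Path S := ⟨S.er e, S.es e, .cons e (.nil (S.es e))⟩

/-- Concatenation of paths (junk -- the first path -- when not composable). -/
def Path.comp (p q : Path S) : Path S :=
  if h : p.src = q.rng then
    ⟨p.rng, q.src, Pth.comp (cast (congrArg (S.Pth p.rng) h) p.pth) q.pth⟩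
  else p

/-- `q` is a prefix of `p`, i.e. `p` extends `q`. -/
def IsPrefix (S : SSA) (q p : Path S) : Prop :=
  ∃ r : Path S, q.src = r.rng ∧ p = q.comp r

/-- Two paths are comparable if one is a prefix of the other. -/
def Comparable (S : SSA) (p q : Path S) : Prop := IsPrefix S p q ∨ IsPrefix S q p

/-- The extended left action of groupoid arrows on finite paths,
given by the recursive recipe `g · v = r g`, `g · (e μ) = (g · e) (g|_e · μ)`. -/
def pactAux (S : SSA) : ∀ {a b : S.V}, S.G → S.Pth a b → Path S
  | _, _, g, .nil _ => Path.vert S (S.gr g)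
  | _, _, g, .cons e p => (Path.ofEdge S (S.act g e)).comp (pactAux S (S.res g e) p)

/-- The extended left action `g · μ` on finite paths. -/
def pact (S : SSA) (g : S.G) (p : Path S) : Path S := pactAux S g p.pth

/-- The extended restriction map, given by `g|_v = g` and `g|_{e μ} = (g|_e)|_μ`. -/
def presAux (S : SSA) : ∀ {a b : S.V}, S.G → S.Pth a b → S.G
  | _, _, g, .nil _ => g
  | _, _, g, .cons e p => presAux S (S.res g e) p

/-- The extended restriction map `g |_μ` on finite paths. -/
def pres (S : SSA) (g : S.G) (p : Path S) : S.G := presAux S g p.pth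

/-- `g` strongly fixes the path `p` : `g · p = p` and `g|_p = s p`. -/
def SFix (S : SSA) (g : S.G) (p : Path S) : Prop :=
  S.gs g = p.rng ∧ pact S g p = p ∧ pres S g p = S.one p.src

/-- `p` is a minimal strongly `g`-fixed path. -/
def MinSFix (S : SSA) (g : S.G) (p : Path S) : Prop :=
  SFix S g p ∧ ∀ q : Path S, IsPrefix S q p → q ≠ p → ¬ SFix S g q

/-- `g` is a unit of the groupoid (an element of `G⁰`). -/
def IsUnitArrow (S : SSA) (g : S.G) : Prop := g = S.one (S.gs g)

/-- `g` fixes every path in `s(g)E^*`. -/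
def FixesAll (S : SSA) (g : S.G) : Prop :=
  ∀ p : Path S, p.rng = S.gs g → pact S g p = p

/-- Condition (Fin): every `g` admits at most finitely many minimal strongly
`g`-fixed paths. -/
def CondFin (S : SSA) : Prop := ∀ g : S.G, {p : Path S | MinSFix S g p}.Finite

/-- Condition (Evr): if `g` fixes every path in `s(g)E^*` then `g` strongly fixes
some path in `s(g)E^*`. -/
def CondEvr (S : SSA) : Prop := ∀ g : S.G, FixesAll S g → ∃ p : Path S, SFix S g p

/-- `p` is a `g`-cycle: a path of positive length with `g · s(p) = r(p)`. -/
def GCycle (S : SSA) (g : S.G) (p : Path S) : Prop :=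
  1 ≤ p.length ∧ S.gs g = p.src ∧ S.gr g = p.rng

/-- The vertex `v` receives at least two distinct edges. -/
def HasEntranceVert (S : SSA) (v : S.V) : Prop :=
  ∃ e f : S.E, e ≠ f ∧ S.er e = v ∧ S.er f = v

/-- Base vertices of a finite path. -/
def Path.baseVerts (p : Path S) : Set S.V :=
  insert p.rng {v : S.V | ∃ e ∈ p.toList, S.es e = v}

/-- A finite path has an entrance. -/
def Path.hasEntrance (p : Path S) : Prop := ∃ v ∈ p.baseVerts, HasEntranceVert S v

/-- Condition (Cyc): every `G`-cycle has an entrance. -/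
def CondCyc (S : SSA) : Prop := ∀ (g : S.G) (p : Path S), GCycle S g p → p.hasEntrance

/-- `g` has slack. -/
def HasSlack (S : SSA) (g : S.G) : Prop :=
  ∃ F : Finset (Path S), (∀ p ∈ F, SFix S g p) ∧
    ∀ q : Path S, q.rng = S.gs g → ∃ p ∈ F, Comparable S p q

/-- Condition (Sla): if `g` fixes every path in `s(g)E^*` then `g` has slack. -/
def CondSla (S : SSA) : Prop := ∀ g : S.G, FixesAll S g → HasSlack S g

def InfPath.rng (ξ : InfPath S) : S.V := S.er (ξ.seq 0)

/-- Base vertices of an infinite path. -/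
def InfPath.baseVerts (ξ : InfPath S) : Set S.V := {v : S.V | ∃ n, S.er (ξ.seq n) = v}

/-- An infinite path has an entrance. -/
def InfPath.hasEntrance (ξ : InfPath S) : Prop := ∃ v ∈ ξ.baseVerts, HasEntranceVert S v

/-- The finite path `p` is a prefix of the infinite path `ξ`. -/
def PrefixOfInf (S : SSA) (p : Path S) (ξ : InfPath S) : Prop :=
  p.rng = ξ.rng ∧ ∀ i : ℕ, i < p.length → p.toList[i]? = some (ξ.seq i)

/-- Finite or infinite paths. -/
abbrev GenPath (S : SSA) : Type := Path S ⊕ InfPath S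

/-- The finite path `p` is a prefix of the finite or infinite path `ξ`. -/
def GPrefix (S : SSA) (p : Path S) : GenPath S → Prop
  | .inl q => IsPrefix S p q
  | .inr ξ => PrefixOfInf S p ξ

/-- The set `vE¹` of edges received by the vertex `v`. -/
def recvSet (S : SSA) (v : S.V) : Set S.E := {e : S.E | S.er e = v}

/-- A vertex is singular if it is a source or an infinite receiver. -/
def Singular (S : SSA) (v : S.V) : Prop := recvSet S v = ∅ ∨ (recvSet S v).Infinite

/-- A vertex is regular if it is not singular. -/
def Regular (S : SSA) (v : S.V) : Prop := ¬ Singular S v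

/-- The preorder `v ≪ w`: there is `v'` with `vE^*v' ≠ ∅` and `v'Gw ≠ ∅`. -/
def ll (S : SSA) (v w : S.V) : Prop :=
  ∃ (p : Path S) (g : S.G), p.rng = v ∧ S.gr g = p.src ∧ S.gs g = w

/-- Cofinality of the self-similar action: for every boundary path (a finite path
with singular source, or an infinite path) and every vertex `v`, some base vertex
`w` of the path satisfies `v ≪ w`. -/
def Cofinal (S : SSA) : Prop :=
  (∀ p : Path S, Singular S p.src → ∀ v : S.V, ∃ w ∈ p.baseVerts, ll S v w) ∧
  (∀ ξ : InfPath S, ∀ v : S.V, ∃ w ∈ ξ.baseVerts, ll S v w)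

def Hereditary (S : SSA) (W : Set S.V) : Prop :=
  ∀ v ∈ W, ∀ p : Path S, p.rng = v → p.src ∈ W

def Saturated (S : SSA) (W : Set S.V) : Prop :=
  ∀ w : S.V, Regular S w → (∀ e : S.E, S.er e = w → S.es e ∈ W) → w ∈ W

def GInvariant (S : SSA) (W : Set S.V) : Prop := ∀ g : S.G, S.gs g ∈ W → S.gr g ∈ W

/-- `(G,E)`-invariant subsets of `E⁰`: `G`-invariant, hereditary and saturated. -/
def SSAInvariant (S : SSA) (W : Set S.V) : Prop :=
  GInvariant S W ∧ Hereditary S W ∧ Saturated S W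

/-- Condition (Con): every vertex is reachable from a `G`-cycle with an entrance. -/
def CondCon (S : SSA) : Prop :=
  ∀ v : S.V, ∃ p : Path S, p.rng = v ∧
    ∃ (g : S.G) (c : Path S), GCycle S g c ∧ c.hasEntrance ∧ p.src ∈ c.baseVerts

/-- The underlying set (with zero `none`) of the inverse semigroup `S(G,E)`. -/
abbrev SGE (S : SSA) : Type := Option (Path S × S.G × Path S)

/-- Well-formedness of a triple `(α, g, β)` : `r g = s α` and `s g = s β`. -/
def SGE.wf (S : SSA) : SGE S → Prop
  | none => True
  | some (α, g, β) => S.gr g = α.src ∧ S.gs g = β.src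

/-- The idempotent `f_α = (α, s α, α)`. -/
def fIdem (S : SSA) (α : Path S) : SGE S := some (α, S.one α.src, α)

/-- The involution `(α,g,β)* = (β,g⁻¹,α)` on `S(G,E)`. -/
def sgeStar (S : SSA) : SGE S → SGE S
  | none => none
  | some (α, g, β) => some (β, S.inv g, α)

/-- The multiplication of the inverse semigroup `S(G,E)`. -/
def sgeMul (S : SSA) : SGE S → SGE S → SGE S
  | none, _ => none
  | some _, none => none
  | some (α, g, β), some (γ, h, δ) =>
    if SGE.wf S (some (α, g, β)) ∧ SGE.wf S (some (γ, h, δ)) then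
      if h1 : ∃ β' : Path S, β.src = Path.rng β' ∧ γ = β.comp β' then
        some (α.comp (pact S g h1.choose), S.mul (pres S g h1.choose) h, δ)
      else if h2 : ∃ γ' : Path S, γ.src = Path.rng γ' ∧ β = γ.comp γ' then
        some (α, S.mul g (S.inv (pres S (S.inv h) h2.choose)),
          δ.comp (pact S (S.inv h) h2.choose))
      else none
    else none

/-- Membership in the subsemigroup `S₀(G,E)` (with zero): triples with `|α| = |β|`. -/
def domS0 (S : SSA) (x : SGE S) : Prop :=
  SGE.wf S x ∧ (x = none ∨ ∃ (α : Path S) (g : S.G) (β : Path S),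
    x = some (α, g, β) ∧ α.length = β.length)

/-- Membership in the subsemigroup `S₀₀(G,E)` (with zero): triples `(g·β, g|_β, β)`. -/
def domS00 (S : SSA) (x : SGE S) : Prop :=
  SGE.wf S x ∧ (x = none ∨ ∃ (g : S.G) (β : Path S),
    S.gs g = β.rng ∧ x = some (pact S g β, pres S g β, β))

/-- `S(G,E)` as raw inverse-semigroup data. -/
def sgeSem (S : SSA) : RawSem (SGE S) := ⟨sgeMul S, sgeStar S, none, SGE.wf S⟩

/-- `S₀(G,E)` as raw inverse-semigroup data. -/
def sgeSem0 (S : SSA) : RawSem (SGE S) := ⟨sgeMul S, sgeStar S, none, domS0 S⟩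

/-- `S₀₀(G,E)` as raw inverse-semigroup data. -/
def sgeSem00 (S : SSA) : RawSem (SGE S) := ⟨sgeMul S, sgeStar S, none, domS00 S⟩

/-- The inductive extension of `σ_⋈` to finite paths:
`σ_⋈(h, s h) = 1`, `σ_⋈(h, e μ) = σ_⋈(h, e) σ_⋈(h|_e, μ)`. -/
def twAux (S : SSA) (σB : S.G → S.E → ℂ) : ∀ {a b : S.V}, S.G → S.Pth a b → ℂ
  | _, _, _, .nil _ => 1
  | _, _, g, .cons e p => σB g e * twAux S σB (S.res g e) p

/-- The extension `σ_⋈ : G * E^* → 𝕋` of a twist to finite paths. -/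
def twP (S : SSA) (σB : S.G → S.E → ℂ) (g : S.G) (p : Path S) : ℂ := twAux S σB g p.pth

/-- The `2`-cocycle `ω_σ` on `S(G,E)` induced by a twist `σ` of `(G,E)`. -/
def omg (S : SSA) (T : Twist S) : SGE S → SGE S → ℂ := fun x y =>
  match x, y with
  | some (_, g, β), some (γ, h, _) =>
    if h1 : ∃ β' : Path S, β.src = Path.rng β' ∧ γ = β.comp β' then
      twP S T.σB g h1.choose * T.σG (pres S g h1.choose) h
    else if h2 : ∃ γ' : Path S, γ.src = Path.rng γ' ∧ β = γ.comp γ' then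
      T.σG g (S.inv (pres S (S.inv h) h2.choose)) * twP S T.σB h (pact S (S.inv h) h2.choose)
    else 1
  | _, _ => 1

end SSA


namespace SSA

variable {S : SSA}

theorem inv_inv_aux (g : S.G) : S.inv (S.inv g) = g := by
  have h1 := S.mul_assoc' (S.inv (S.inv g)) (S.inv g) g (by rw [S.gs_inv]) (by rw [S.gs_inv])
  rw [S.inv_mul', S.inv_mul'] at h1
  have h2 := S.one_mul' g
  have h3 := S.mul_one' (S.inv (S.inv g))
  rw [S.gs_inv, S.gr_inv] at h3
  rw [S.gs_inv, h2, h3] at h1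
  exact h1.symm

theorem idem_one (x : S.G) (h : S.gs x = S.gr x) (hx : S.mul x x = x) :
    x = S.one (S.gs x) := by
  have h1 := S.mul_assoc' (S.inv x) x x (by rw [S.gs_inv]) h
  rw [hx, S.inv_mul', h, S.one_mul', ← h] at h1
  exact h1

theorem eq_inv_of_mul (x y : S.G) (h : S.gs x = S.gr y) (hx : S.mul x y = S.one (S.gs y)) :
    x = S.inv y := by
  have h1 := S.mul_assoc' x y (S.inv y) h (by rw [S.gr_inv])
  have h2 := S.one_mul' (S.inv y)
  rw [S.gr_inv] at h2
  rw [hx, S.mul_inv', ← h, S.mul_one', h2] at h1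
  exact h1.symm

theorem res_one (e : S.E) : S.res (S.one (S.er e)) e = S.one (S.es e) := by
  have h := S.res_mul (S.one (S.er e)) (S.one (S.er e)) e (by rw [S.gs_one, S.gr_one])
    (S.gs_one _)
  have h1 := S.one_mul' (S.one (S.er e))
  rw [S.gr_one] at h1
  have h2 := S.gs_res (S.one (S.er e)) e (S.gs_one _)
  have h3 := S.gr_res (S.one (S.er e)) e (S.gs_one _)
  rw [h1, S.act_one] at h
  rw [S.act_one] at h3
  rw [idem_one _ (h2.trans h3.symm) h.symm, h2]

/-! Paths. -/

theorem comp_mk {a b c : S.V} (p : S.Pth a b) (q : S.Pth b c) :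
    Path.comp ⟨a, b, p⟩ ⟨b, c, q⟩ = ⟨a, c, p.comp q⟩ := by
  simp [Path.comp]

theorem comp_rng (p q : Path S) : (p.comp q).rng = p.rng := by
  unfold Path.comp; split <;> rfl

theorem comp_src (p q : Path S) (h : p.src = q.rng) : (p.comp q).src = q.src := by
  unfold Path.comp; rw [dif_pos h]

theorem Pth.toList_comp {a b c : S.V} (p : S.Pth a b) (q : S.Pth b c) :
    (p.comp q).toList = p.toList ++ q.toList := by
  induction p with
  | nil v => rfl
  | cons e p ih => simp [Pth.comp, Pth.toList, ih]

theorem toList_comp (p q : Path S) (h : p.src = q.rng) :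
    (p.comp q).toList = p.toList ++ q.toList := by
  obtain ⟨a, b, p⟩ := p
  obtain ⟨b', c, q⟩ := q
  obtain rfl : b = b' := h
  rw [comp_mk]
  exact Pth.toList_comp p q

theorem Pth.length_eq {a b : S.V} (p : S.Pth a b) : p.length = p.toList.length := by
  induction p with
  | nil v => rfl
  | cons e p ih => simp [Pth.length, Pth.toList, ih]

theorem length_eq (p : Path S) : p.length = p.toList.length := Pth.length_eq p.pth

theorem comp_length (p q : Path S) (h : p.src = q.rng) :
    (p.comp q).length = p.length + q.length := by
  simp [length_eq, toList_comp p q h]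

theorem Pth.ext_list {a b : S.V} (p : S.Pth a b) :
    ∀ {a' b' : S.V} (q : S.Pth a' b'), a = a' → p.toList = q.toList →
      (⟨a, b, p⟩ : Path S) = ⟨a', b', q⟩ := by
  induction p with
  | nil v =>
    intro a' b' q h hl
    cases q with
    | nil w => subst h; rfl
    | cons e q => simp [Pth.toList] at hl
  | cons e p ih =>
    intro a' b' q h hl
    cases q with
    | nil w => simp [Pth.toList] at hl
    | cons e' q =>
      simp only [Pth.toList, List.cons.injEq] at hl
      obtain ⟨rfl, hl⟩ := hl
      have := ih q rfl hl
      simp only [Path.mk.injEq, true_and] at this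
      obtain ⟨rfl, hq⟩ := this
      rw [eq_of_heq hq]

theorem ext_list (p q : Path S) (h : p.rng = q.rng) (hl : p.toList = q.toList) : p = q :=
  Pth.ext_list p.pth q.pth h hl

theorem comp_assoc (p q r : Path S) (h1 : p.src = q.rng) (h2 : q.src = r.rng) :
    (p.comp q).comp r = p.comp (q.comp r) := by
  apply ext_list
  · simp [comp_rng]
  · rw [toList_comp _ _ (by rw [comp_src _ _ h1, h2]), toList_comp _ _ h1,
      toList_comp _ _ (by rw [comp_rng, h1]), toList_comp _ _ h2, List.append_assoc]

theorem comp_cancel (p q r : Path S) (h1 : p.src = q.rng) (h2 : p.src = r.rng)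
    (h : p.comp q = p.comp r) : q = r := by
  apply ext_list
  · rw [← h1, h2]
  · have := congrArg Path.toList h
    rw [toList_comp _ _ h1, toList_comp _ _ h2] at this
    exact List.append_cancel_left this

theorem eq_vert (p : Path S) (h : p.length = 0) : p = Path.vert S p.rng := by
  apply ext_list
  · rfl
  · rw [length_eq, List.length_eq_zero_iff] at h
    rw [h]; rfl

theorem comp_vert (p : Path S) : p.comp (Path.vert S p.src) = p := by
  apply ext_list
  · simp [comp_rng]
  · rw [toList_comp _ _ rfl]; simp [Path.vert, Path.toList, Pth.toList]

theorem vert_comp (p : Path S) : (Path.vert S p.rng).comp p = p := by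
  apply ext_list
  · simp [comp_rng, Path.vert]
  · rw [toList_comp _ _ rfl]; simp [Path.vert, Path.toList, Pth.toList]

theorem path_ind {P : Path S → Prop} (h0 : ∀ v, P (Path.vert S v))
    (h1 : ∀ e q, S.es e = Path.rng q → P q → P ((Path.ofEdge S e).comp q)) (p : Path S) :
    P p := by
  obtain ⟨a, b, p⟩ := p
  induction p with
  | nil v => exact h0 v
  | cons e p ih =>
    have := h1 e ⟨_, _, p⟩ rfl ih
    rw [Path.ofEdge, comp_mk] at this
    exact this

theorem comparable_aux (m n : List S.E) (p : Path S) : ∀ q : Path S, p.rng = q.rng →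
    p.toList ++ m = q.toList ++ n →
    (∃ r : Path S, p.src = r.rng ∧ q = p.comp r) ∨
      (∃ r : Path S, q.src = r.rng ∧ p = q.comp r) := by
  refine path_ind (P := fun p => ∀ q : Path S, p.rng = q.rng →
    p.toList ++ m = q.toList ++ n →
    (∃ r : Path S, p.src = r.rng ∧ q = p.comp r) ∨
      (∃ r : Path S, q.src = r.rng ∧ p = q.comp r)) ?_ ?_ p
  · intro v q h _
    left
    have h : v = q.rng := h
    subst h
    exact ⟨q, rfl, (vert_comp q).symm⟩
  · intro e p he ih q
    refine path_ind (P := fun q => ((Path.ofEdge S e).comp p).rng = q.rng →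
      ((Path.ofEdge S e).comp p).toList ++ m = q.toList ++ n →
      (∃ r : Path S, ((Path.ofEdge S e).comp p).src = r.rng ∧
        q = ((Path.ofEdge S e).comp p).comp r) ∨
      (∃ r : Path S, q.src = r.rng ∧ ((Path.ofEdge S e).comp p) = q.comp r)) ?_ ?_ q
    · intro v h _
      right
      have h : _ = v := h
      subst h
      exact ⟨_, rfl, (vert_comp _).symm⟩
    · intro e' q he' _ h hl
      rw [toList_comp _ _ he, toList_comp _ _ he'] at hl
      simp only [Path.ofEdge, Path.toList, Pth.toList, List.cons_append, List.nil_append,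
        List.cons.injEq] at hl
      obtain ⟨rfl, hl⟩ := hl
      rcases ih q (he.symm.trans he') hl with ⟨r, hr, rfl⟩ | ⟨r, hr, rfl⟩
      · left
        exact ⟨r, by rw [comp_src _ _ he, hr], by rw [comp_assoc _ _ _ he hr]⟩
      · right
        exact ⟨r, by rw [comp_src _ _ he', hr], by rw [comp_assoc _ _ _ he' hr]⟩

theorem comparable (p q m n : Path S) (hm : p.src = m.rng) (hn : q.src = n.rng)
    (h : p.comp m = q.comp n) :
    (∃ r : Path S, p.src = r.rng ∧ q = p.comp r) ∨
      (∃ r : Path S, q.src = r.rng ∧ p = q.comp r) := by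
  apply comparable_aux m.toList n.toList p q
  · rw [← comp_rng p m, h, comp_rng]
  · rw [← toList_comp _ _ hm, ← toList_comp _ _ hn, h]

/-! Extended action. -/

theorem pact_vert (g : S.G) (v : S.V) : pact S g (Path.vert S v) = Path.vert S (S.gr g) := rfl
theorem pres_vert (g : S.G) (v : S.V) : pres S g (Path.vert S v) = g := rfl
theorem twP_vert (b : S.G → S.E → ℂ) (g : S.G) (v : S.V) : twP S b g (Path.vert S v) = 1 := rfl

theorem pact_cons (g : S.G) (e : S.E) (q : Path S) (h : S.es e = q.rng) :
    pact S g ((Path.ofEdge S e).comp q) =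
      (Path.ofEdge S (S.act g e)).comp (pact S (S.res g e) q) := by
  obtain ⟨a, b, q⟩ := q
  have h : S.es e = a := h
  subst h
  rw [Path.ofEdge, comp_mk]; rfl

theorem pres_cons (g : S.G) (e : S.E) (q : Path S) (h : S.es e = q.rng) :
    pres S g ((Path.ofEdge S e).comp q) = pres S (S.res g e) q := by
  obtain ⟨a, b, q⟩ := q
  have h : S.es e = a := h
  subst h
  rw [Path.ofEdge, comp_mk]; rfl

theorem twP_cons (B : S.G → S.E → ℂ) (g : S.G) (e : S.E) (q : Path S) (h : S.es e = q.rng) :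
    twP S B g ((Path.ofEdge S e).comp q) = B g e * twP S B (S.res g e) q := by
  obtain ⟨a, b, q⟩ := q
  have h : S.es e = a := h
  subst h
  rw [Path.ofEdge, comp_mk]; rfl

theorem basics (p : Path S) : ∀ g : S.G, S.gs g = p.rng →
    (pact S g p).rng = S.gr g ∧ (pact S g p).src = S.gr (pres S g p) ∧
      S.gs (pres S g p) = p.src ∧ (pact S g p).length = p.length := by
  refine path_ind (P := fun p => ∀ g : S.G, S.gs g = p.rng →
    (pact S g p).rng = S.gr g ∧ (pact S g p).src = S.gr (pres S g p) ∧
      S.gs (pres S g p) = p.src ∧ (pact S g p).length = p.length) ?_ ?_ p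
  · intro v g h
    exact ⟨rfl, rfl, h, rfl⟩
  · intro e q he ih g hg
    rw [comp_rng] at hg
    have hg : S.gs g = S.er e := hg
    obtain ⟨h1, h2, h3, h4⟩ := ih (S.res g e) (by rw [S.gs_res _ _ hg, he])
    have h5 : (Path.ofEdge S (S.act g e)).src = (pact S (S.res g e) q).rng := by
      rw [h1, S.gr_res _ _ hg]; rfl
    rw [pact_cons _ _ _ he, pres_cons _ _ _ he, comp_rng, comp_src _ _ h5, comp_src _ _ he,
      comp_length _ _ h5, comp_length _ _ he]
    exact ⟨S.er_act _ _ hg, h2, h3, by rw [h4]; rfl⟩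

theorem pact_rng (g : S.G) (p : Path S) (h : S.gs g = p.rng) : (pact S g p).rng = S.gr g :=
  (basics p g h).1
theorem pact_src (g : S.G) (p : Path S) (h : S.gs g = p.rng) :
    (pact S g p).src = S.gr (pres S g p) := (basics p g h).2.1
theorem gs_pres (g : S.G) (p : Path S) (h : S.gs g = p.rng) : S.gs (pres S g p) = p.src :=
  (basics p g h).2.2.1
theorem pact_length (g : S.G) (p : Path S) (h : S.gs g = p.rng) :
    (pact S g p).length = p.length := (basics p g h).2.2.2

theorem comp_formulas (B : S.G → S.E → ℂ) (q p : Path S) : ∀ g : S.G, S.gs g = p.rng →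
    p.src = q.rng →
    pact S g (p.comp q) = (pact S g p).comp (pact S (pres S g p) q) ∧
    pres S g (p.comp q) = pres S (pres S g p) q ∧
    twP S B g (p.comp q) = twP S B g p * twP S B (pres S g p) q := by
  refine path_ind (P := fun p => ∀ g : S.G, S.gs g = p.rng →
    p.src = q.rng →
    pact S g (p.comp q) = (pact S g p).comp (pact S (pres S g p) q) ∧
    pres S g (p.comp q) = pres S (pres S g p) q ∧
    twP S B g (p.comp q) = twP S B g p * twP S B (pres S g p) q) ?_ ?_ p
  · intro v g hg h
    have h : v = q.rng := h
    subst h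
    rw [vert_comp, pact_vert, pres_vert, twP_vert, ← pact_rng g q hg, vert_comp, one_mul]
    exact ⟨rfl, rfl, rfl⟩
  · intro e p he ih g hg h
    rw [comp_rng] at hg
    have hg : S.gs g = S.er e := hg
    rw [comp_src _ _ he] at h
    have hg' : S.gs (S.res g e) = p.rng := by rw [S.gs_res _ _ hg, he]
    obtain ⟨h1, h2, h3⟩ := ih (S.res g e) hg' h
    have he' : S.es e = (p.comp q).rng := by rw [comp_rng, he]
    rw [comp_assoc _ _ _ he h, pact_cons _ _ _ he', pres_cons _ _ _ he', twP_cons _ _ _ _ he',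
      pact_cons _ _ _ he, pres_cons _ _ _ he, twP_cons _ _ _ _ he, h1, h2, h3, mul_assoc]
    refine ⟨?_, rfl, rfl⟩
    rw [comp_assoc]
    · rw [pact_rng _ _ hg', S.gr_res _ _ hg]; rfl
    · rw [pact_src _ _ hg', pact_rng]
      rw [gs_pres _ _ hg', h]

theorem mul_formulas (p : Path S) : ∀ g h : S.G, S.gs g = S.gr h → S.gs h = p.rng →
    pact S (S.mul g h) p = pact S g (pact S h p) ∧
    pres S (S.mul g h) p = S.mul (pres S g (pact S h p)) (pres S h p) := by
  refine path_ind (P := fun p => ∀ g h : S.G, S.gs g = S.gr h → S.gs h = p.rng →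
    pact S (S.mul g h) p = pact S g (pact S h p) ∧
    pres S (S.mul g h) p = S.mul (pres S g (pact S h p)) (pres S h p)) ?_ ?_ p
  · intro v g h hgh hh
    simp only [pact_vert, pres_vert, S.gr_mul _ _ hgh, and_self]
  · intro e p he ih g h hgh hh
    rw [comp_rng] at hh
    have hh : S.gs h = S.er e := hh
    have h1 : S.gs g = S.er (S.act h e) := by rw [S.er_act _ _ hh, hgh]
    have h2 : S.gs (S.res h e) = p.rng := by rw [S.gs_res _ _ hh, he]
    have h3 : S.gs (S.res g (S.act h e)) = S.gr (S.res h e) := by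
      rw [S.gs_res _ _ h1, S.gr_res _ _ hh]
    have h4 : S.es (S.act h e) = (pact S (S.res h e) p).rng := by
      rw [pact_rng _ _ h2, S.gr_res _ _ hh]
    obtain ⟨i1, i2⟩ := ih _ _ h3 h2
    rw [pact_cons _ _ _ he, pact_cons _ _ _ he, pact_cons _ _ _ h4, pres_cons _ _ _ he,
      pres_cons _ _ _ he, pres_cons _ _ _ h4, S.act_mul _ _ _ hgh hh, S.res_mul _ _ _ hgh hh,
      i1, i2]
    exact ⟨rfl, rfl⟩

theorem one_formulas (p : Path S) :
    pact S (S.one p.rng) p = p ∧ pres S (S.one p.rng) p = S.one p.src := by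
  refine path_ind (P := fun p =>
    pact S (S.one p.rng) p = p ∧ pres S (S.one p.rng) p = S.one p.src) ?_ ?_ p
  · intro v
    constructor
    · rw [pact_vert, S.gr_one]; rfl
    · rfl
  · intro e p he ih
    rw [pact_cons _ _ _ he, pres_cons _ _ _ he, comp_rng, comp_src _ _ he]
    change (Path.ofEdge S (S.act (S.one (S.er e)) e)).comp (pact S (S.res (S.one (S.er e)) e) p)
      = _ ∧ pres S (S.res (S.one (S.er e)) e) p = _
    rw [S.act_one, res_one, he, ih.1, ih.2]
    exact ⟨rfl, rfl⟩

theorem norm_twP (T : Twist S) (p : Path S) : ∀ g : S.G, S.gs g = p.rng →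
    ‖twP S T.σB g p‖ = 1 := by
  refine path_ind (P := fun p => ∀ g : S.G, S.gs g = p.rng →
    ‖twP S T.σB g p‖ = 1) ?_ ?_ p
  · intro v g _
    rw [twP_vert, norm_one]
  · intro e p he ih g hg
    rw [comp_rng] at hg
    have hg : S.gs g = S.er e := hg
    rw [twP_cons _ _ _ _ he, norm_mul, T.σB_unimod _ _ hg, ih _ (by rw [S.gs_res _ _ hg, he]),
      one_mul]

theorem conj_mul_one {z : ℂ} (h : ‖z‖ = 1) : (starRingEnd ℂ) z * z = 1 := by
  rw [mul_comm, Complex.mul_conj, Complex.normSq_eq_norm_sq, h]; simp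

theorem edge_cocycle (T : Twist S) (g h : S.G) (e : S.E) (hg : S.gs g = S.gr h)
    (hh : S.gs h = S.er e) :
    T.σB h e * T.σB g (S.act h e) * T.σG (S.res g (S.act h e)) (S.res h e) =
      T.σG g h * T.σB (S.mul g h) e := by
  have h0 := T.σB_cocycle g h e hg hh
  have h1 := conj_mul_one (T.σB_unimod (S.mul g h) e (by rw [S.gs_mul _ _ hg, hh]))
  have h3 : S.gs g = S.er (S.act h e) := by rw [S.er_act _ _ hh, hg]
  have h2 := conj_mul_one (T.σG_unimod (S.res g (S.act h e)) (S.res h e)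
    (by rw [S.gs_res _ _ h3, S.gr_res _ _ hh]))
  linear_combination (T.σB (S.mul g h) e * T.σG (S.res g (S.act h e)) (S.res h e)) * h0
    - T.σB h e * T.σB g (S.act h e) * T.σG (S.res g (S.act h e)) (S.res h e) * h1
    + T.σG g h * T.σB (S.mul g h) e * h2

theorem path_cocycle (T : Twist S) (p : Path S) : ∀ g h : S.G, S.gs g = S.gr h →
    S.gs h = p.rng →
    twP S T.σB h p * twP S T.σB g (pact S h p) * T.σG (pres S g (pact S h p)) (pres S h p) =
      T.σG g h * twP S T.σB (S.mul g h) p := by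
  refine path_ind (P := fun p => ∀ g h : S.G, S.gs g = S.gr h →
    S.gs h = p.rng →
    twP S T.σB h p * twP S T.σB g (pact S h p) * T.σG (pres S g (pact S h p)) (pres S h p) =
      T.σG g h * twP S T.σB (S.mul g h) p) ?_ ?_ p
  · intro v g h hgh hh
    simp only [pact_vert, pres_vert, twP_vert, one_mul, mul_one]
  · intro e p he ih g h hgh hh
    rw [comp_rng] at hh
    have hh : S.gs h = S.er e := hh
    have h1 : S.gs g = S.er (S.act h e) := by rw [S.er_act _ _ hh, hgh]
    have h2 : S.gs (S.res h e) = p.rng := by rw [S.gs_res _ _ hh, he]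
    have h3 : S.gs (S.res g (S.act h e)) = S.gr (S.res h e) := by
      rw [S.gs_res _ _ h1, S.gr_res _ _ hh]
    have h4 : S.es (S.act h e) = (pact S (S.res h e) p).rng := by
      rw [pact_rng _ _ h2, S.gr_res _ _ hh]
    have i := ih _ _ h3 h2
    have j := edge_cocycle T g h e hgh hh
    rw [pact_cons _ _ _ he, pres_cons _ _ _ he, pres_cons _ _ _ h4, twP_cons _ _ _ _ he,
      twP_cons _ _ _ _ he, twP_cons _ _ _ _ h4, S.res_mul _ _ _ hgh hh]
    linear_combination T.σB h e * T.σB g (S.act h e) * i +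
      twP S T.σB (S.mul (S.res g (S.act h e)) (S.res h e)) p * j

/-- Undoing the action of `h`. -/
theorem inv_formulas (h : S.G) (p : Path S) (hp : S.gr h = p.rng) :
    pact S h (pact S (S.inv h) p) = p ∧
      pres S h (pact S (S.inv h) p) = S.inv (pres S (S.inv h) p) := by
  have h0 : S.gs (S.inv h) = p.rng := by rw [S.gs_inv, hp]
  have h1 := mul_formulas p h (S.inv h) (by rw [S.gr_inv]) h0
  rw [S.mul_inv', hp, (one_formulas p).1, (one_formulas p).2] at h1
  refine ⟨h1.1.symm, eq_inv_of_mul _ _ ?_ ?_⟩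
  · rw [gs_pres, pact_src _ _ h0]
    rw [pact_rng _ _ h0, S.gr_inv]
  · rw [← h1.2, gs_pres _ _ h0]

theorem inv_formulas' (h : S.G) (p : Path S) (hp : S.gs h = p.rng) :
    pact S (S.inv h) (pact S h p) = p := by
  have := (inv_formulas (S.inv h) p (by rw [S.gr_inv, hp])).1
  rwa [inv_inv_aux] at this

theorem omg_one (T : Twist S) (α : Path S) (g : S.G) (β γ : Path S) (h : S.G) (δ β' : Path S)
    (h1 : β.src = β'.rng) (h2 : γ = β.comp β') :
    omg S T (some (α, g, β)) (some (γ, h, δ)) = twP S T.σB g β' * T.σG (pres S g β') h := by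
  have hex : ∃ β' : Path S, β.src = Path.rng β' ∧ γ = β.comp β' := ⟨β', h1, h2⟩
  simp only [omg]
  rw [dif_pos hex]
  have : hex.choose = β' :=
    comp_cancel β _ _ hex.choose_spec.1 h1 (hex.choose_spec.2.symm.trans h2)
  rw [this]

theorem omg_two (T : Twist S) (α : Path S) (g : S.G) (β γ : Path S) (h : S.G) (δ γ' : Path S)
    (hw : S.gr h = γ.src)
    (h1 : γ.src = γ'.rng) (h2 : β = γ.comp γ') :
    omg S T (some (α, g, β)) (some (γ, h, δ)) =
      T.σG g (S.inv (pres S (S.inv h) γ')) * twP S T.σB h (pact S (S.inv h) γ') := by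
  by_cases hex : ∃ β' : Path S, β.src = Path.rng β' ∧ γ = β.comp β'
  · obtain ⟨β', h3, h4⟩ := hex
    rw [omg_one T α g β γ h δ β' h3 h4]
    have l1 := comp_length _ _ h1
    have l2 := comp_length _ _ h3
    rw [← h2] at l1
    rw [← h4] at l2
    rw [eq_vert β' (by omega), eq_vert γ' (by omega)]
    simp only [pact_vert, pres_vert, twP_vert, inv_inv_aux, one_mul, mul_one]
  · have hex2 : ∃ γ' : Path S, γ.src = Path.rng γ' ∧ β = γ.comp γ' := ⟨γ', h1, h2⟩
    simp only [omg]
    rw [dif_neg hex, dif_pos hex2]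
    have : hex2.choose = γ' :=
      comp_cancel γ _ _ hex2.choose_spec.1 h1 (hex2.choose_spec.2.symm.trans h2)
    rw [this]

theorem sgeMul_cases (α : Path S) (g : S.G) (β γ : Path S) (h : S.G) (δ : Path S)
    (hx : SGE.wf S (some (α, g, β))) (hy : SGE.wf S (some (γ, h, δ))) :
    (∃ β' : Path S, β.src = β'.rng ∧ γ = β.comp β' ∧
      sgeMul S (some (α, g, β)) (some (γ, h, δ)) =
        some (α.comp (pact S g β'), S.mul (pres S g β') h, δ)) ∨
    (∃ γ' : Path S, γ.src = γ'.rng ∧ β = γ.comp γ' ∧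
      sgeMul S (some (α, g, β)) (some (γ, h, δ)) =
        some (α, S.mul g (S.inv (pres S (S.inv h) γ')), δ.comp (pact S (S.inv h) γ'))) ∨
    ((¬ ∃ β' : Path S, β.src = β'.rng ∧ γ = β.comp β') ∧
      (¬ ∃ γ' : Path S, γ.src = γ'.rng ∧ β = γ.comp γ') ∧
      sgeMul S (some (α, g, β)) (some (γ, h, δ)) = none) := by
  simp only [sgeMul]
  rw [if_pos ⟨hx, hy⟩]
  by_cases h1 : ∃ β' : Path S, β.src = Path.rng β' ∧ γ = β.comp β'
  · left
    exact ⟨h1.choose, h1.choose_spec.1, h1.choose_spec.2, by rw [dif_pos h1]⟩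
  · right
    by_cases h2 : ∃ γ' : Path S, γ.src = Path.rng γ' ∧ β = γ.comp γ'
    · left
      exact ⟨h2.choose, h2.choose_spec.1, h2.choose_spec.2, by rw [dif_neg h1, dif_pos h2]⟩
    · right
      exact ⟨h1, h2, by rw [dif_neg h1, dif_neg h2]⟩

theorem exists_match (α : Path S) (g : S.G) (β γ : Path S) (h : S.G) (δ : Path S)
    (hx : SGE.wf S (some (α, g, β))) (hy : SGE.wf S (some (γ, h, δ)))
    (hne : sgeMul S (some (α, g, β)) (some (γ, h, δ)) ≠ none) :
    ∃ μ ν : Path S, β.src = μ.rng ∧ δ.src = ν.rng ∧ β.comp μ = γ.comp (pact S h ν) ∧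
      (μ.length = 0 ∨ ν.length = 0) := by
  rcases sgeMul_cases α g β γ h δ hx hy with ⟨β', h1, h2, -⟩ | ⟨γ', h1, h2, -⟩ | ⟨-, -, h3⟩
  · refine ⟨β', Path.vert S δ.src, h1, rfl, ?_, Or.inr rfl⟩
    rw [pact_vert, hy.1, comp_vert, h2]
  · refine ⟨Path.vert S β.src, pact S (S.inv h) γ', rfl, ?_, ?_, Or.inl rfl⟩
    · rw [pact_rng, S.gr_inv, hy.2]
      rw [S.gs_inv, hy.1, h1]
    · rw [comp_vert, (inv_formulas h γ' (by rw [hy.1, h1])).1, h2]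
  · exact absurd h3 hne

theorem key (T : Twist S) (α : Path S) (g : S.G) (β γ : Path S) (h : S.G) (δ : Path S)
    (hx : SGE.wf S (some (α, g, β))) (hy : SGE.wf S (some (γ, h, δ)))
    (μ ν : Path S) (hμ : β.src = μ.rng) (hν : δ.src = ν.rng)
    (hm : β.comp μ = γ.comp (pact S h ν)) :
    ∃ (a : Path S) (l : S.G) (b ρ : Path S),
      sgeMul S (some (α, g, β)) (some (γ, h, δ)) = some (a, l, b) ∧
      SGE.wf S (some (a, l, b)) ∧ b.src = ρ.rng ∧ b.comp ρ = δ.comp ν ∧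
      pres S l ρ = S.mul (pres S g μ) (pres S h ν) ∧
      a.comp (pact S l ρ) = α.comp (pact S g μ) ∧
      omg S T (some (α, g, β)) (some (γ, h, δ)) * twP S T.σB l ρ =
        twP S T.σB g μ * twP S T.σB h ν * T.σG (pres S g μ) (pres S h ν) ∧
      α.length ≤ a.length ∧ δ.length ≤ b.length ∧
      a.length + ρ.length = α.length + μ.length ∧ b.length + ρ.length = δ.length + ν.length := by
  have hgα : S.gr g = α.src := hx.1
  have hgβ : S.gs g = β.src := hx.2
  have hhγ : S.gr h = γ.src := hy.1
  have hhδ : S.gs h = δ.src := hy.2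
  have hhν : S.gs h = ν.rng := by rw [hhδ, hν]
  have hγν : γ.src = (pact S h ν).rng := by rw [pact_rng _ _ hhν, hhγ]
  rcases sgeMul_cases α g β γ h δ hx hy with ⟨β', h1, h2, h3⟩ | ⟨γ', h1, h2, h3⟩ | ⟨h1, h2, -⟩
  · have hgb : S.gs g = β'.rng := by rw [hgβ, h1]
    have hα : α.src = (pact S g β').rng := by rw [pact_rng _ _ hgb, hgα]
    have hs : β'.src = γ.src := by rw [h2, comp_src _ _ h1]
    have hβν : β'.src = (pact S h ν).rng := by rw [hs, hγν]
    have hl : S.gs (pres S g β') = S.gr h := by rw [gs_pres _ _ hgb, hs, hhγ]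
    have hμ' : μ = β'.comp (pact S h ν) := by
      apply comp_cancel β _ _ hμ (by rw [comp_rng, h1])
      rw [hm, ← comp_assoc _ _ _ h1 hβν, ← h2]
    obtain ⟨c1, c2, c3⟩ := comp_formulas T.σB (pact S h ν) β' g hgb hβν
    obtain ⟨m1, m2⟩ := mul_formulas ν (pres S g β') h hl hhν
    have hc := path_cocycle T ν (pres S g β') h hl hhν
    refine ⟨_, _, _, ν, h3, ⟨?_, ?_⟩, hν, rfl, ?_, ?_, ?_, ?_, le_rfl, ?_, rfl⟩
    · rw [S.gr_mul _ _ hl, comp_src _ _ hα, pact_src _ _ hgb]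
    · rw [S.gs_mul _ _ hl, hhδ]
    · rw [m2, hμ', c2]
    · rw [m1, hμ', c1, comp_assoc _ _ _ hα]
      rw [pact_src _ _ hgb, pact_rng]
      rw [hl, pact_rng _ _ hhν]
    · rw [omg_one T α g β γ h δ β' h1 h2, hμ', c2, c3]
      linear_combination (-twP S T.σB g β') * hc
    · rw [comp_length _ _ hα]; omega
    · rw [comp_length _ _ hα, hμ', comp_length _ _ hβν, pact_length _ _ hgb,
        pact_length _ _ hhν]; omega
  · have hhg : S.gr h = γ'.rng := by rw [hhγ, h1]
    have hig : S.gs (S.inv h) = γ'.rng := by rw [S.gs_inv, hhg]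
    obtain ⟨i1, i2⟩ := inv_formulas h γ' hhg
    have hβs : β.src = γ'.src := by rw [h2, comp_src _ _ h1]
    have hγμ : γ'.src = μ.rng := by rw [← hβs, hμ]
    have e1 : pact S h ν = γ'.comp μ := by
      apply comp_cancel γ _ _ hγν (by rw [comp_rng, h1])
      rw [← hm, ← comp_assoc _ _ _ h1 hγμ, ← h2]
    set ν0 := pact S (S.inv h) γ' with hν0
    set m := pres S (S.inv h) γ' with hmdef
    have hr0 : ν0.rng = S.gs h := by rw [hν0, pact_rng _ _ hig, S.gr_inv]
    have hs0 : ν0.src = S.gr m := pact_src _ _ hig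
    have hmμ : S.gs m = μ.rng := by rw [hmdef, gs_pres _ _ hig, hγμ]
    have hmβ : S.gs m = β.src := by rw [hmμ, hμ]
    set ρ := pact S m μ with hρ
    have hρr : ρ.rng = S.gr m := pact_rng _ _ hmμ
    have e2 : ν = ν0.comp ρ := by
      have := inv_formulas' h ν hhν
      rw [e1, (comp_formulas T.σB μ γ' (S.inv h) hig hγμ).1] at this
      exact this.symm
    have e3 : pact S (S.inv m) ρ = μ := inv_formulas' m μ hmμ
    have h0ρ : ν0.src = ρ.rng := by rw [hs0, hρr]
    obtain ⟨c1, c2, c3⟩ := comp_formulas T.σB ρ ν0 h hr0.symm h0ρ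
    have hgm : S.gs g = S.gr (S.inv m) := by rw [S.gr_inv, hmβ, hgβ]
    have hmρ : S.gs (S.inv m) = ρ.rng := by rw [S.gs_inv, hρr]
    obtain ⟨m1, m2⟩ := mul_formulas ρ g (S.inv m) hgm hmρ
    have hc := path_cocycle T ρ g (S.inv m) hgm hmρ
    rw [e3] at m1 m2 hc
    have hδ0 : δ.src = ν0.rng := by rw [hr0, hhδ]
    refine ⟨_, _, _, ρ, h3, ⟨?_, ?_⟩, ?_, ?_, ?_, ?_, ?_, le_rfl, ?_, ?_, ?_⟩
    · rw [S.gr_mul _ _ hgm, hgα]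
    · rw [S.gs_mul _ _ hgm, comp_src _ _ hδ0, S.gs_inv, hs0]
    · rw [comp_src _ _ hδ0, h0ρ]
    · rw [comp_assoc _ _ _ hδ0 h0ρ, e2]
    · rw [m2, e2, c2, i2]
    · rw [m1]
    · rw [omg_two T α g β γ h δ γ' hhγ h1 h2, e2, c2, c3, i2, ← hν0, ← hmdef]
      linear_combination (-twP S T.σB h ν0) * hc
    · rw [comp_length _ _ hδ0]; omega
    · rw [hρ, pact_length _ _ hmμ]
    · rw [comp_length _ _ hδ0, e2, comp_length _ _ h0ρ]; omega
  · rcases comparable β γ μ (pact S h ν) hμ hγν hm with hc | hc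
    · exact absurd hc h1
    · exact absurd hc h2

theorem omg_norm (T : Twist S) (x y : SGE S) (hx : SGE.wf S x) (hy : SGE.wf S y)
    (hne : sgeMul S x y ≠ none) : ‖omg S T x y‖ = 1 := by
  obtain _ | ⟨α, g, β⟩ := x
  · simp [omg]
  obtain _ | ⟨γ, h, δ⟩ := y
  · simp [omg]
  obtain ⟨μ, ν, hμ, hν, hm, -⟩ := exists_match α g β γ h δ hx hy hne
  obtain ⟨a, l, b, ρ, -, hw, hbρ, -, -, -, ho, -⟩ := key T α g β γ h δ hx hy μ ν hμ hν hm
  have hgμ : S.gs g = μ.rng := hx.2.trans hμ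
  have hhν : S.gs h = ν.rng := hy.2.trans hν
  have hcomp : S.gs (pres S g μ) = S.gr (pres S h ν) := by
    rw [gs_pres _ _ hgμ, ← pact_src _ _ hhν, ← comp_src _ _ hμ, hm, comp_src]
    rw [pact_rng _ _ hhν, hy.1]
  have := congrArg norm ho
  rw [norm_mul, norm_mul, norm_mul, norm_twP T _ _ hgμ, norm_twP T _ _ hhν,
    norm_twP T _ _ (hw.2.trans hbρ), T.σG_unimod _ _ hcomp] at this
  simpa using this

theorem omg_cocycle (T : Twist S) (x y z : SGE S) (hx : SGE.wf S x) (hy : SGE.wf S y)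
    (hz : SGE.wf S z) (hne : sgeMul S (sgeMul S x y) z ≠ none) :
    omg S T y z * omg S T x (sgeMul S y z) = omg S T x y * omg S T (sgeMul S x y) z := by
  have hxy : sgeMul S x y ≠ none := by
    intro h; rw [h] at hne; exact hne rfl
  obtain _ | ⟨α, g, β⟩ := x
  · exact absurd rfl hxy
  obtain _ | ⟨γ, h, δ⟩ := y
  · exact absurd rfl hxy
  obtain ⟨μ₀, ν₀, hμ₀, hν₀, hm₀, hl₀⟩ := exists_match α g β γ h δ hx hy hxy
  obtain ⟨a, l, b, ρ₀, hp, hwp, hρ₀, hb, -, -, -, hα, hδ, hle1, hle2⟩ :=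
    key T α g β γ h δ hx hy μ₀ ν₀ hμ₀ hν₀ hm₀
  have hρ₀0 : ρ₀.length = 0 := by omega
  rw [eq_vert ρ₀ hρ₀0, ← hρ₀, comp_vert] at hb
  rw [hp] at hne
  obtain _ | ⟨ε, k, ζ⟩ := z
  · exact absurd rfl hne
  obtain ⟨ρ₁, τ, hρ₁, hτ, hm₁, hl₁⟩ := exists_match a l b ε k ζ hwp hz hne
  have hhν₀ : S.gs h = ν₀.rng := hy.2.trans hν₀
  have hν₁ : ν₀.src = ρ₁.rng := by rw [← hρ₁, hb, comp_src _ _ hν₀]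
  have hpr : S.gs (pres S h ν₀) = ρ₁.rng := by rw [gs_pres _ _ hhν₀, hν₁]
  have hγ₀ : γ.src = (pact S h ν₀).rng := by rw [pact_rng _ _ hhν₀, hy.1]
  have hps : (pact S h ν₀).src = (pact S (pres S h ν₀) ρ₁).rng := by
    rw [pact_src _ _ hhν₀, pact_rng _ _ hpr]
  have hμ₁ : μ₀.src = (pact S (pres S h ν₀) ρ₁).rng := by
    rw [← hps, ← comp_src _ _ hμ₀, hm₀, comp_src _ _ hγ₀]
  obtain ⟨ν, hνd⟩ : ∃ ν, ν = ν₀.comp ρ₁ := ⟨_, rfl⟩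
  obtain ⟨μ, hμd⟩ : ∃ μ, μ = μ₀.comp (pact S (pres S h ν₀) ρ₁) := ⟨_, rfl⟩
  have hμ : β.src = μ.rng := by rw [hμd, comp_rng, hμ₀]
  have hν : δ.src = ν.rng := by rw [hνd, comp_rng, hν₀]
  have hm : β.comp μ = γ.comp (pact S h ν) := by
    rw [hμd, hνd, ← comp_assoc _ _ _ hμ₀ hμ₁, hm₀,
      (comp_formulas T.σB ρ₁ ν₀ h hhν₀ hν₁).1, comp_assoc _ _ _ hγ₀ hps]
  have hm' : δ.comp ν = ε.comp (pact S k τ) := by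
    rw [hνd, ← comp_assoc _ _ _ hν₀ hν₁, ← hb, hm₁]
  have hmin : μ.length = 0 ∨ ν.length = 0 ∨ τ.length = 0 := by
    have q1 := comp_length _ _ hμ₁
    have q2 := comp_length _ _ hν₁
    rw [pact_length _ _ hpr, ← hμd] at q1
    rw [← hνd] at q2
    omega
  have hgμ : S.gs g = μ.rng := hx.2.trans hμ
  have hhν : S.gs h = ν.rng := hy.2.trans hν
  have hkτ : S.gs k = τ.rng := hz.2.trans hτ
  have hcomp1 : S.gs (pres S g μ) = S.gr (pres S h ν) := by
    rw [gs_pres _ _ hgμ, ← pact_src _ _ hhν, ← comp_src _ _ hμ, hm, comp_src]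
    rw [pact_rng _ _ hhν, hy.1]
  have hcomp2 : S.gs (pres S h ν) = S.gr (pres S k τ) := by
    rw [gs_pres _ _ hhν, ← pact_src _ _ hkτ, ← comp_src _ _ hν, hm', comp_src]
    rw [pact_rng _ _ hkτ, hz.1]
  clear hm₁ hρ₁ hl₁
  obtain ⟨a', l', b', ρ', hp', hwp', hρ', hb', hl', ha', ho', hn1, hn2, hn3, hn4⟩ :=
    key T α g β γ h δ hx hy μ ν hμ hν hm
  obtain ⟨A, L, B, R, HP, HW, HR, HB, HL, HA, HO, N1, N2, N3, N4⟩ :=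
    key T a' l' b' ε k ζ hwp' hz ρ' τ hρ' hτ (hb'.trans hm')
  obtain ⟨c, m, d, r, jp, jw, jr, jb, jl, ja, jo, j1, j2, j3, j4⟩ :=
    key T γ h δ ε k ζ hy hz ν τ hν hτ hm'
  obtain ⟨C, M, D, Q, kp, kw, kr, kb, kl, ka, ko, k1, k2, k3, k4⟩ :=
    key T α g β c m d hx jw μ r hμ jr (hm.trans ja.symm)
  rw [hp', jp]
  have hR : R.length = 0 := by omega
  have hQ : Q.length = 0 := by omega
  rw [eq_vert R hR, twP_vert, mul_one, hl'] at HO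
  rw [eq_vert Q hQ, twP_vert, mul_one, jl] at ko
  have t1 : twP S T.σB l' ρ' ≠ 0 := by
    intro h0
    have := norm_twP T ρ' l' (hwp'.2.trans hρ')
    rw [h0] at this; simp at this
  have t2 : twP S T.σB m r ≠ 0 := by
    intro h0
    have := norm_twP T r m (jw.2.trans jr)
    rw [h0] at this; simp at this
  have hG := T.σG_cocycle _ _ _ hcomp1 hcomp2
  rw [HO, ko]
  linear_combination twP S T.σB g μ * T.σG (pres S g μ) (S.mul (pres S h ν) (pres S k τ)) * jo
    - twP S T.σB k τ * T.σG (S.mul (pres S g μ) (pres S h ν)) (pres S k τ) * ho'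
    - twP S T.σB g μ * twP S T.σB h ν * twP S T.σB k τ * hG

end SSA

/-- The formula for `ω_σ` gives a well-defined normalised
`𝕋`-valued `2`-cocycle on `S(G,E)`: the defining formulas hold for every prefix
decomposition, `ω_σ` is unimodular on pairs with nonzero product, satisfies the
cocycle identity whenever `r ⬝ s ⬝ t ≠ 0`, and `ω_σ(f_α, f_α) = 1`. -/
theorem statement16 (S : SSA) (T : SSA.Twist S) :
    (∀ (α : SSA.Path S) (g : S.G) (β γ : SSA.Path S) (h : S.G) (δ β' : SSA.Path S),
      SSA.SGE.wf S (some (α, g, β)) → SSA.SGE.wf S (some (γ, h, δ)) →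
      β.src = β'.rng → γ = β.comp β' →
      SSA.omg S T (some (α, g, β)) (some (γ, h, δ)) =
        SSA.twP S T.σB g β' * T.σG (SSA.pres S g β') h) ∧
    (∀ (α : SSA.Path S) (g : S.G) (β γ : SSA.Path S) (h : S.G) (δ γ' : SSA.Path S),
      SSA.SGE.wf S (some (α, g, β)) → SSA.SGE.wf S (some (γ, h, δ)) →
      γ.src = γ'.rng → β = γ.comp γ' →
      SSA.omg S T (some (α, g, β)) (some (γ, h, δ)) =
        T.σG g (S.inv (SSA.pres S (S.inv h) γ')) *
          SSA.twP S T.σB h (SSA.pact S (S.inv h) γ')) ∧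
    (∀ α : SSA.Path S, SSA.omg S T (SSA.fIdem S α) (SSA.fIdem S α) = 1) ∧
    (∀ x y : SSA.SGE S, SSA.SGE.wf S x → SSA.SGE.wf S y →
      SSA.sgeMul S x y ≠ none → ‖SSA.omg S T x y‖ = 1) ∧
    (∀ x y z : SSA.SGE S, SSA.SGE.wf S x → SSA.SGE.wf S y → SSA.SGE.wf S z →
      SSA.sgeMul S (SSA.sgeMul S x y) z ≠ none →
      SSA.omg S T y z * SSA.omg S T x (SSA.sgeMul S y z) =
        SSA.omg S T x y * SSA.omg S T (SSA.sgeMul S x y) z) := by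
  refine ⟨?_, ?_, ?_, ?_, ?_⟩
  · intro α g β γ h δ β' _ _ h1 h2
    exact SSA.omg_one T α g β γ h δ β' h1 h2
  · intro α g β γ h δ γ' _ hy h1 h2
    exact SSA.omg_two T α g β γ h δ γ' hy.1 h1 h2
  · intro α
    have h1 := T.σG_one_left (S.one α.src)
    rw [S.gr_one] at h1
    have h2 := SSA.omg_one T α (S.one α.src) α α (S.one α.src) α (SSA.Path.vert S α.src) rfl
      (SSA.comp_vert α).symm
    rw [SSA.twP_vert, SSA.pres_vert, h1, one_mul] at h2
    exact h2
  · exact SSA.omg_norm T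
  · exact SSA.omg_cocycle T
end
end

section
/- Let G be a discrete groupoid. (1) For any self-similar action of G on a directed graph E, the set X = E¹*G = {(e,h) : e ∈ E¹, h ∈ G, s(e) = r(h)} with s(e,h) = s(h), r(e,h) = r(e), left action g·(e,h) = (g·e, g|_e·h) (defined for s(g) = r(e)) and right action (e,h)·k = (e, h·k) (defined for s(h) = r(k)) is a self-correspondence over G: both are groupoid actions, the left and right actions commute, and the right action is free, i.e. the map X*G → X×X, (x,g) ↦ (x·g, x), is injective. (2) Conversely, every self-correspondence over G is isomorphic to one of this form: for every self-correspondence X over G there exist a directed graph E with E⁰ = G⁰, a self-similar action of G on E, and a bijection E¹*G → X that intertwines the source and range maps and the left and right G-actions. -/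
noncomputable section

/-- A discrete groupoid, encoded by total operations with axioms on composable
inputs. -/
structure Gpd where
  V : Type
  G : Type
  gs : G → V
  gr : G → V
  one : V → G
  mul : G → G → G
  inv : G → G
  gs_one : ∀ v, gs (one v) = v
  gr_one : ∀ v, gr (one v) = v
  gs_mul : ∀ g h, gs g = gr h → gs (mul g h) = gs h
  gr_mul : ∀ g h, gs g = gr h → gr (mul g h) = gr g
  mul_assoc' : ∀ g h k, gs g = gr h → gs h = gr k → mul (mul g h) k = mul g (mul h k)
  one_mul' : ∀ g, mul (one (gr g)) g = g
  mul_one' : ∀ g, mul g (one (gs g)) = g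
  gs_inv : ∀ g, gs (inv g) = gr g
  gr_inv : ∀ g, gr (inv g) = gs g
  mul_inv' : ∀ g, mul g (inv g) = one (gr g)
  inv_mul' : ∀ g, mul (inv g) g = one (gs g)

/-- A self-similar action of the groupoid `Γ` on a directed graph with vertex set
`Γ.V`: a left action on edges together with a restriction map satisfying the
`1`-cocycle identities. -/
structure SSAOver (Γ : Gpd) where
  E : Type
  es : E → Γ.V
  er : E → Γ.V
  act : Γ.G → E → E
  res : Γ.G → E → Γ.G
  er_act : ∀ g e, Γ.gs g = er e → er (act g e) = Γ.gr g
  act_one : ∀ e, act (Γ.one (er e)) e = e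
  act_mul : ∀ g h e, Γ.gs g = Γ.gr h → Γ.gs h = er e →
    act (Γ.mul g h) e = act g (act h e)
  gs_res : ∀ g e, Γ.gs g = er e → Γ.gs (res g e) = es e
  gr_res : ∀ g e, Γ.gs g = er e → Γ.gr (res g e) = es (act g e)
  res_mul : ∀ g h e, Γ.gs g = Γ.gr h → Γ.gs h = er e →
    res (Γ.mul g h) e = Γ.mul (res g (act h e)) (res h e)

/-- A self-correspondence over the discrete groupoid `Γ` on the set `X`:
anchor maps, commuting left and right `Γ`-actions, with the right action free. -/
structure SelfCorrOn (Γ : Gpd) (X : Type) where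
  xs : X → Γ.V
  xr : X → Γ.V
  lact : Γ.G → X → X
  ract : X → Γ.G → X
  xr_lact : ∀ g x, Γ.gs g = xr x → xr (lact g x) = Γ.gr g
  xs_lact : ∀ g x, Γ.gs g = xr x → xs (lact g x) = xs x
  lact_one : ∀ x, lact (Γ.one (xr x)) x = x
  lact_mul : ∀ g h x, Γ.gs g = Γ.gr h → Γ.gs h = xr x →
    lact (Γ.mul g h) x = lact g (lact h x)
  xs_ract : ∀ x k, xs x = Γ.gr k → xs (ract x k) = Γ.gs k
  xr_ract : ∀ x k, xs x = Γ.gr k → xr (ract x k) = xr x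
  ract_one : ∀ x, ract x (Γ.one (xs x)) = x
  ract_mul : ∀ x k l, xs x = Γ.gr k → Γ.gs k = Γ.gr l →
    ract x (Γ.mul k l) = ract (ract x k) l
  comm : ∀ g x k, Γ.gs g = xr x → xs x = Γ.gr k → ract (lact g x) k = lact g (ract x k)
  free : ∀ x k x' k', xs x = Γ.gr k → xs x' = Γ.gr k' →
    ract x k = ract x' k' → x = x' → k = k'

/-- The carrier `E¹ * G = {(e, h) : s e = r h}` of the self-correspondence
associated to a self-similar action. -/
def corrCarrier (Γ : Gpd) (A : SSAOver Γ) : Type := {p : A.E × Γ.G // A.es p.1 = Γ.gr p.2}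

theorem SSAOver.res_one {Γ : Gpd} (A : SSAOver Γ) (e : A.E) :
    A.res (Γ.one (A.er e)) e = Γ.one (A.es e) := by
  have h1 := Γ.gs_one (A.er e)
  have h2 := Γ.gr_one (A.er e)
  have hm : Γ.mul (Γ.one (A.er e)) (Γ.one (A.er e)) = Γ.one (A.er e) := by
    have := Γ.one_mul' (Γ.one (A.er e))
    rwa [h2] at this
  have h3 := A.res_mul (Γ.one (A.er e)) (Γ.one (A.er e)) e (h1.trans h2.symm) h1
  rw [hm, A.act_one] at h3
  have hs := A.gs_res _ _ h1
  have hr := A.gr_res _ _ h1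
  rw [A.act_one] at hr
  generalize A.res (Γ.one (A.er e)) e = r at *
  have h4 := Γ.mul_assoc' (Γ.inv r) r r (by rw [Γ.gs_inv]) (hs.trans hr.symm)
  rw [← h3, Γ.inv_mul', hs, ← hr, Γ.one_mul'] at h4
  rw [h4, hr]

open Classical in
/-- The self-correspondence attached to a self-similar action. -/
def SSAOver.corr {Γ : Gpd} (A : SSAOver Γ) :
    SelfCorrOn Γ {p : A.E × Γ.G // A.es p.1 = Γ.gr p.2} where
  xs p := Γ.gs p.1.2
  xr p := A.er p.1.1
  lact g p := if h : Γ.gs g = A.er p.1.1 then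
    ⟨(A.act g p.1.1, Γ.mul (A.res g p.1.1) p.1.2), by
      show A.es (A.act g p.1.1) = Γ.gr (Γ.mul (A.res g p.1.1) p.1.2)
      rw [Γ.gr_mul _ _ ((A.gs_res _ _ h).trans p.2), A.gr_res _ _ h]⟩ else p
  ract p k := if h : Γ.gs p.1.2 = Γ.gr k then
    ⟨(p.1.1, Γ.mul p.1.2 k), by
      show A.es p.1.1 = Γ.gr (Γ.mul p.1.2 k)
      rw [Γ.gr_mul _ _ h, p.2]⟩ else p
  xr_lact g p h := by simp only [h, dif_pos]; exact A.er_act _ _ h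
  xs_lact g p h := by
    simp only [h, dif_pos]; exact Γ.gs_mul _ _ ((A.gs_res _ _ h).trans p.2)
  lact_one p := by
    rw [dif_pos (Γ.gs_one _)]
    apply Subtype.ext
    apply Prod.ext
    · exact A.act_one _
    · show Γ.mul (A.res (Γ.one (A.er p.1.1)) p.1.1) p.1.2 = p.1.2
      rw [A.res_one, p.2, Γ.one_mul']
  lact_mul g h p h1 h2 := by
    have h3 : Γ.gs (Γ.mul g h) = A.er p.1.1 := (Γ.gs_mul _ _ h1).trans h2
    have h4 : Γ.gs g = A.er (A.act h p.1.1) := by rw [A.er_act _ _ h2, h1]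
    rw [dif_pos h3]
    simp only [dif_pos h2]
    rw [dif_pos h4]
    apply Subtype.ext
    apply Prod.ext
    · exact A.act_mul _ _ _ h1 h2
    · show Γ.mul (A.res (Γ.mul g h) p.1.1) p.1.2 = 
        Γ.mul (A.res g (A.act h p.1.1)) (Γ.mul (A.res h p.1.1) p.1.2)
      rw [A.res_mul _ _ _ h1 h2, Γ.mul_assoc']
      · rw [A.gs_res _ _ h4, A.gr_res _ _ h2]
      · rw [A.gs_res _ _ h2, p.2]
  xs_ract p k h := by simp only [dif_pos h]; exact Γ.gs_mul _ _ h
  xr_ract p k h := by simp only [dif_pos h]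
  ract_one p := by
    rw [dif_pos (Γ.gr_one _).symm]
    apply Subtype.ext
    apply Prod.ext
    · rfl
    · exact Γ.mul_one' _
  ract_mul p k l h1 h2 := by
    have h3 : Γ.gs p.1.2 = Γ.gr (Γ.mul k l) := by rw [Γ.gr_mul _ _ h2, h1]
    have h4 : Γ.gs (Γ.mul p.1.2 k) = Γ.gr l := by rw [Γ.gs_mul _ _ h1, h2]
    rw [dif_pos h3]
    simp only [dif_pos h1]
    rw [dif_pos h4]
    apply Subtype.ext
    apply Prod.ext
    · rfl
    · exact (Γ.mul_assoc' _ _ _ h1 h2).symm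
  comm g p k h1 h2 := by
    have h0 : Γ.gs (A.res g p.1.1) = Γ.gr p.1.2 := (A.gs_res _ _ h1).trans p.2
    have h3 : Γ.gs (Γ.mul (A.res g p.1.1) p.1.2) = Γ.gr k := by rw [Γ.gs_mul _ _ h0, h2]
    simp only [dif_pos h1, dif_pos h2]
    rw [dif_pos h3]
    apply Subtype.ext
    apply Prod.ext
    · rfl
    · exact Γ.mul_assoc' _ _ _ h0 h2
  free p k p' k' h1 h2 h3 h4 := by
    subst h4
    simp only [dif_pos h1, dif_pos h2] at h3
    have h5 : Γ.mul p.1.2 k = Γ.mul p.1.2 k' := congrArg (fun q => q.1.2) h3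
    have key : ∀ k, Γ.gs p.1.2 = Γ.gr k → Γ.mul (Γ.inv p.1.2) (Γ.mul p.1.2 k) = k := by
      intro k hk
      rw [← Γ.mul_assoc' _ _ _ (Γ.gs_inv _) hk, Γ.inv_mul', hk, Γ.one_mul']
    rw [← key k h1, h5, key k' h2]

theorem SSAOver.corr_lact {Γ : Gpd} (A : SSAOver Γ) (g : Γ.G)
    (p q : {p : A.E × Γ.G // A.es p.1 = Γ.gr p.2}) (h : Γ.gs g = A.er p.1.1)
    (hq : q.1 = (A.act g p.1.1, Γ.mul (A.res g p.1.1) p.1.2)) : A.corr.lact g p = q := by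
  apply Subtype.ext
  rw [hq]
  simp only [SSAOver.corr, dif_pos h]

theorem SSAOver.corr_ract {Γ : Gpd} (A : SSAOver Γ)
    (p q : {p : A.E × Γ.G // A.es p.1 = Γ.gr p.2}) (k : Γ.G) (h : Γ.gs p.1.2 = Γ.gr k)
    (hq : q.1 = (p.1.1, Γ.mul p.1.2 k)) : A.corr.ract p k = q := by
  apply Subtype.ext
  rw [hq]
  simp only [SSAOver.corr, dif_pos h]

/-- Orbit representatives for the right action. -/
theorem SelfCorrOn.exists_rep {Γ : Gpd} {X : Type} (C : SelfCorrOn Γ X) :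
    ∃ (rep : X → X) (gam : X → Γ.G), (∀ x, C.xs (rep x) = Γ.gr (gam x)) ∧
      (∀ x, C.ract (rep x) (gam x) = x) ∧
      (∀ x k, C.xs x = Γ.gr k → rep (C.ract x k) = rep x) := by
  let S : Setoid X :=
    { r := fun x y => ∃ k, C.xs x = Γ.gr k ∧ C.ract x k = y
      iseqv :=
        { refl := fun x => ⟨Γ.one (C.xs x), (Γ.gr_one _).symm, C.ract_one x⟩
          symm := by
            rintro x y ⟨k, hk, rfl⟩
            refine ⟨Γ.inv k, ?_, ?_⟩
            · rw [C.xs_ract _ _ hk, Γ.gr_inv]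
            · rw [← C.ract_mul _ _ _ hk (Γ.gr_inv _).symm, Γ.mul_inv', ← hk, C.ract_one]
          trans := by
            rintro x y z ⟨k, hk, rfl⟩ ⟨l, hl, rfl⟩
            rw [C.xs_ract _ _ hk] at hl
            exact ⟨Γ.mul k l, by rw [Γ.gr_mul _ _ hl, hk], C.ract_mul _ _ _ hk hl⟩ } }
  have h : ∀ x : X, ∃ k, C.xs (Quotient.mk S x).out = Γ.gr k ∧
      C.ract (Quotient.mk S x).out k = x := fun x => Quotient.mk_out (s := S) x
  choose gam h1 h2 using h
  refine ⟨fun x => (Quotient.mk S x).out, gam, h1, h2, fun x k hk => ?_⟩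
  have : Quotient.mk S (C.ract x k) = Quotient.mk S x :=
    (Quotient.sound (s := S) ⟨k, hk, rfl⟩).symm
  show (Quotient.mk S (C.ract x k)).out = (Quotient.mk S x).out
  rw [this]

theorem SelfCorrOn.exists_ssa {Γ : Gpd} {X : Type} (C : SelfCorrOn Γ X) :
    ∃ (A : SSAOver Γ) (φ : corrCarrier Γ A → X),
      Function.Bijective φ ∧
      (∀ p : corrCarrier Γ A, C.xr (φ p) = A.er p.1.1) ∧
      (∀ p : corrCarrier Γ A, C.xs (φ p) = Γ.gs p.1.2) ∧
      (∀ (g : Γ.G) (p q : corrCarrier Γ A), Γ.gs g = A.er p.1.1 →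
        q.1 = (A.act g p.1.1, Γ.mul (A.res g p.1.1) p.1.2) → φ q = C.lact g (φ p)) ∧
      (∀ (p q : corrCarrier Γ A) (k : Γ.G), Γ.gs p.1.2 = Γ.gr k →
        q.1 = (p.1.1, Γ.mul p.1.2 k) → φ q = C.ract (φ p) k) := by
  obtain ⟨rep, gam, hrg, hx, hrep⟩ := C.exists_rep
  have hidem : ∀ x, rep (rep x) = rep x := fun x => by
    have := hrep (rep x) (gam x) (hrg x)
    rw [hx] at this
    exact this.symm
  have hxr : ∀ x, C.xr (rep x) = C.xr x := fun x => by
    have := C.xr_ract (rep x) (gam x) (hrg x)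
    rw [hx] at this
    exact this.symm
  have hgs : ∀ x, Γ.gs (gam x) = C.xs x := fun x => by
    have := C.xs_ract (rep x) (gam x) (hrg x)
    rw [hx] at this
    exact this.symm
  have hgam : ∀ x k, C.xs x = Γ.gr k → gam (C.ract x k) = Γ.mul (gam x) k := fun x k hk => by
    have hc : Γ.gs (gam x) = Γ.gr k := (hgs x).trans hk
    refine C.free (rep (C.ract x k)) _ (rep x) _ (hrg _) ?_ ?_ (hrep x k hk)
    · rw [Γ.gr_mul _ _ hc, hrg]
    · rw [hx, C.ract_mul _ _ _ (hrg x) hc, hx]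
  have hgam1 : ∀ x, rep x = x → gam x = Γ.one (C.xs x) := fun x h => by
    refine C.free x _ x _ ?_ (Γ.gr_one _).symm ?_ rfl
    · rw [← hrg, h]
    · rw [C.ract_one]
      have := hx x
      rwa [h] at this
  -- the left translate of a decomposed element
  have hl : ∀ g x, Γ.gs g = C.xr x →
      C.lact g x = C.ract (C.lact g (rep x)) (gam x) := fun g x h => by
    rw [C.comm _ _ _ (by rw [hxr, h]) (hrg x), hx]
  have hlx : ∀ g x, Γ.gs g = C.xr x → C.xs (C.lact g (rep x)) = Γ.gr (gam x) := fun g x h => by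
    rw [C.xs_lact _ _ (by rw [hxr, h]), hrg]
  let A : SSAOver Γ :=
    { E := {x : X // rep x = x}
      es := fun e => C.xs e.1
      er := fun e => C.xr e.1
      act := fun g e => ⟨rep (C.lact g e.1), hidem _⟩
      res := fun g e => gam (C.lact g e.1)
      er_act := fun g e h => by
        show C.xr (rep (C.lact g e.1)) = _
        rw [hxr, C.xr_lact _ _ h]
      act_one := fun e => Subtype.ext (by
        show rep (C.lact (Γ.one (C.xr e.1)) e.1) = e.1
        rw [C.lact_one, e.2])
      act_mul := fun g h e h1 h2 => Subtype.ext (by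
        show rep (C.lact (Γ.mul g h) e.1) = rep (C.lact g (rep (C.lact h e.1)))
        have h3 : Γ.gs g = C.xr (C.lact h e.1) := by rw [C.xr_lact _ _ h2, h1]
        rw [C.lact_mul _ _ _ h1 h2, hl g (C.lact h e.1) h3, hrep _ _ (hlx _ _ h3)])
      gs_res := fun g e h => by rw [hgs, C.xs_lact _ _ h]
      gr_res := fun g e h => (hrg _).symm
      res_mul := fun g h e h1 h2 => by
        show gam (C.lact (Γ.mul g h) e.1) =
          Γ.mul (gam (C.lact g (rep (C.lact h e.1)))) (gam (C.lact h e.1))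
        have h3 : Γ.gs g = C.xr (C.lact h e.1) := by rw [C.xr_lact _ _ h2, h1]
        rw [C.lact_mul _ _ _ h1 h2, hl g (C.lact h e.1) h3, hgam _ _ (hlx _ _ h3)] }
  refine ⟨A, fun p => C.ract p.1.1.1 p.1.2, ⟨?_, ?_⟩, ?_, ?_, ?_, ?_⟩
  · rintro ⟨⟨⟨e, he⟩, h⟩, hp⟩ ⟨⟨⟨e', he'⟩, h'⟩, hp'⟩ heq
    change C.xs e = Γ.gr h at hp
    change C.xs e' = Γ.gr h' at hp'
    change C.ract e h = C.ract e' h' at heq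
    have h1 : e = e' := by
      rw [← he, ← he', ← hrep e h hp, ← hrep e' h' hp', heq]
    subst h1
    have h2 : h = h' := C.free e h e h' hp hp' heq rfl
    subst h2
    rfl
  · intro x
    exact ⟨⟨(⟨rep x, hidem x⟩, gam x), hrg x⟩, hx x⟩
  · intro p
    exact C.xr_ract _ _ p.2
  · intro p
    exact C.xs_ract _ _ p.2
  · intro g p q hg hq
    have hp : C.xs p.1.1.1 = Γ.gr p.1.2 := p.2
    change Γ.gs g = C.xr p.1.1.1 at hg
    show C.ract q.1.1.1 q.1.2 = C.lact g (C.ract p.1.1.1 p.1.2)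
    rw [hq]
    show C.ract (rep (C.lact g p.1.1.1)) (Γ.mul (gam (C.lact g p.1.1.1)) p.1.2) = _
    rw [C.ract_mul _ _ _ (hrg _) (by rw [hgs, C.xs_lact _ _ hg, hp]), hx, C.comm _ _ _ hg hp]
  · intro p q k hk hq
    show C.ract q.1.1.1 q.1.2 = C.ract (C.ract p.1.1.1 p.1.2) k
    rw [hq]
    exact C.ract_mul _ _ _ p.2 hk

/-- (1) The set `E¹ * G` with `s(e,h) = s h`, `r(e,h) = r e`,
left action `g · (e,h) = (g·e, g|_e ⬝ h)` and right action `(e,h) · k = (e, h⬝k)`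
is a self-correspondence over `G`.  (2) Every self-correspondence over `G` is
isomorphic to one of this form. -/
theorem statement17 (Γ : Gpd) :
    (∀ A : SSAOver Γ, ∃ C : SelfCorrOn Γ (corrCarrier Γ A),
      (∀ p : corrCarrier Γ A, C.xr p = A.er p.1.1) ∧
      (∀ p : corrCarrier Γ A, C.xs p = Γ.gs p.1.2) ∧
      (∀ (g : Γ.G) (p q : corrCarrier Γ A), Γ.gs g = A.er p.1.1 →
        q.1 = (A.act g p.1.1, Γ.mul (A.res g p.1.1) p.1.2) → C.lact g p = q) ∧
      (∀ (p q : corrCarrier Γ A) (k : Γ.G), Γ.gs p.1.2 = Γ.gr k →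
        q.1 = (p.1.1, Γ.mul p.1.2 k) → C.ract p k = q)) ∧
    (∀ (X : Type) (C : SelfCorrOn Γ X), ∃ (A : SSAOver Γ) (φ : corrCarrier Γ A → X),
      Function.Bijective φ ∧
      (∀ p : corrCarrier Γ A, C.xr (φ p) = A.er p.1.1) ∧
      (∀ p : corrCarrier Γ A, C.xs (φ p) = Γ.gs p.1.2) ∧
      (∀ (g : Γ.G) (p q : corrCarrier Γ A), Γ.gs g = A.er p.1.1 →
        q.1 = (A.act g p.1.1, Γ.mul (A.res g p.1.1) p.1.2) → φ q = C.lact g (φ p)) ∧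
      (∀ (p q : corrCarrier Γ A) (k : Γ.G), Γ.gs p.1.2 = Γ.gr k →
        q.1 = (p.1.1, Γ.mul p.1.2 k) → φ q = C.ract (φ p) k)) := by
  exact ⟨fun A => ⟨A.corr, fun _ => rfl, fun _ => rfl, A.corr_lact, A.corr_ract⟩,
    fun X C => C.exists_ssa⟩

end
end
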